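/- Let p be a prime with p ≠ 2 and p ≠ 5, let e = ν_p(F(p−ε)), and let i ∈ {0, 1, …, π(p)−1} be a Lucas zero with respect to p (i.e., L(i) ≡ 0 (mod p)). Then the sequence λ ↦ |{F(n) mod p^λ : n ≥ 0, n ≡ i (mod π(p))}| / p^λ converges, as λ → ∞, to 1/(2 p^{2e−1} (p+1)). (Equivalently, the Haar measure in ℤ_p of the closure of {F(n) : n ≥ 0, n ≡ i (mod π(p))} equals 1/(2 p^{2e−1} (p+1)).) -/

import Mathlib

/-- The Lucas sequence: `L 0 = 2`, `L 1 = 1`, `L (n+2) = L (n+1) + L n`. -/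
def lucas : ℕ → ℕ
  | 0 => 2
  | 1 => 1
  | n + 2 => lucas (n + 1) + lucas n

/-- The Pisano period of the Fibonacci sequence modulo `p`: the least `m ≥ 1`
with `F (n + m) ≡ F n (mod p)` for all `n`. -/
noncomputable def pisano (p : ℕ) : ℕ :=
  sInf {m | 1 ≤ m ∧ ∀ n, Nat.fib (n + m) ≡ Nat.fib n [MOD p]}

/-- The natural number `p - ε` for `p ∉ {2, 5}`. -/
def pSubEps (p : ℕ) : ℕ := if p % 5 = 1 ∨ p % 5 = 4 then p - 1 else p + 1

/-- The Wall exponent `e = ν_p (F (p - ε))`. -/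
def wallExp (p : ℕ) : ℕ := padicValNat p (Nat.fib (pSubEps p))

theorem lucas_cast (n : ℕ) : (lucas n : ℤ) = 2 * Nat.fib (n + 1) - Nat.fib n := by
  induction n using Nat.twoStepInduction with
  | zero => simp [lucas]
  | one => simp [lucas]
  | more n ih₁ ih₂ =>
    rw [lucas, Nat.cast_add, ih₁, ih₂, Nat.fib_add_two (n := n + 1), Nat.fib_add_two (n := n)]
    push_cast
    ring

theorem fib_add_cast (m n : ℕ) :
    (Nat.fib (m + n) : ℤ) =
      Nat.fib m * Nat.fib (n + 1) + Nat.fib (m + 1) * Nat.fib n - Nat.fib m * Nat.fib n := by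
  cases n with
  | zero => simp
  | succ n =>
    rw [← add_assoc, Nat.fib_add, Nat.fib_add_two (n := n)]
    push_cast
    ring

theorem fib_add_succ_cast (m n : ℕ) :
    (Nat.fib (m + n + 1) : ℤ) =
      Nat.fib m * Nat.fib n + Nat.fib (m + 1) * Nat.fib (n + 1) := by
  exact_mod_cast Nat.fib_add m n

theorem two_mul_fib_add (m n : ℕ) :
    2 * (Nat.fib (m + n) : ℤ) = Nat.fib m * lucas n + lucas m * Nat.fib n := by
  rw [lucas_cast, lucas_cast, fib_add_cast]
  ring

theorem two_mul_lucas_add (m n : ℕ) :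
    2 * (lucas (m + n) : ℤ) = lucas m * lucas n + 5 * (Nat.fib m * Nat.fib n) := by
  rw [lucas_cast, lucas_cast, lucas_cast, fib_add_cast m n, fib_add_succ_cast m n]
  ring

theorem lucas_sq_sub (n : ℕ) :
    (lucas n : ℤ) ^ 2 - 5 * (Nat.fib n : ℤ) ^ 2 = 4 * (-1) ^ n := by
  induction n with
  | zero => simp [lucas]
  | succ n ih =>
    rw [lucas_cast] at ih ⊢
    rw [Nat.fib_add_two, pow_succ (-1 : ℤ)]
    push_cast
    linear_combination -ih

theorem fib_two_mul_eq (n : ℕ) : Nat.fib (2 * n) = Nat.fib n * lucas n := by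
  have h := two_mul_fib_add n n
  rw [← two_mul] at h
  zify
  linarith

/-- First-order expansions of `F (d (k + 1))` and `L (d (k + 1))` in powers of `F d`. -/
theorem exists_fib_mul_expansion (d k : ℕ) :
    (∃ c : ℤ, 2 ^ k * (Nat.fib (d * (k + 1)) : ℤ) =
      (k + 1) * Nat.fib d * lucas d ^ k + Nat.fib d ^ 3 * c) ∧
    ∃ c : ℤ, 2 ^ k * (lucas (d * (k + 1)) : ℤ) = lucas d ^ (k + 1) + Nat.fib d ^ 2 * c := by
  induction k with
  | zero => exact ⟨⟨0, by simp⟩, ⟨0, by simp⟩⟩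
  | succ k ih =>
    obtain ⟨⟨c, hc⟩, ⟨c', hc'⟩⟩ := ih
    have h1 := two_mul_fib_add (d * (k + 1)) d
    have h2 := two_mul_lucas_add (d * (k + 1)) d
    rw [mul_add_one d (k + 1)]
    refine ⟨⟨c * lucas d + c', ?_⟩,
      ⟨c' * lucas d + 5 * ((k + 1) * lucas d ^ k + Nat.fib d ^ 2 * c), ?_⟩⟩
    · push_cast
      linear_combination 2 ^ k * h1 + (lucas d : ℤ) * hc + (Nat.fib d : ℤ) * hc'
    · linear_combination 2 ^ k * h2 + (lucas d : ℤ) * hc' + 5 * (Nat.fib d : ℤ) * hc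

section OddPrime

variable {p : ℕ}

theorem not_dvd_two (hp : p.Prime) (hp2 : p ≠ 2) : ¬ (p : ℤ) ∣ 2 := by
  intro h
  have h' : p ∣ 2 := by exact_mod_cast h
  exact hp2 ((Nat.prime_dvd_prime_iff_eq hp Nat.prime_two).1 h')

theorem not_dvd_five (hp : p.Prime) (hp5 : p ≠ 5) : ¬ (p : ℤ) ∣ 5 := by
  intro h
  have h' : p ∣ 5 := by exact_mod_cast h
  exact hp5 ((Nat.prime_dvd_prime_iff_eq hp Nat.prime_five).1 h')

theorem not_dvd_four_mul_neg_one_pow (hp : p.Prime) (hp2 : p ≠ 2) (n : ℕ) :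
    ¬ (p : ℤ) ∣ 4 * (-1) ^ n := by
  intro h
  rw [(IsUnit.pow n isUnit_one.neg).dvd_mul_right] at h
  exact not_dvd_two hp hp2 ((Nat.prime_iff_prime_int.1 hp).dvd_of_dvd_pow
    (n := 2) (by norm_num; exact h))

theorem not_dvd_lucas_of_dvd_fib (hp : p.Prime) (hp2 : p ≠ 2) {n : ℕ} (h : p ∣ Nat.fib n) :
    ¬ (p : ℤ) ∣ lucas n := by
  intro h'
  apply not_dvd_four_mul_neg_one_pow hp hp2 n
  rw [← lucas_sq_sub]
  exact dvd_sub (dvd_pow h' two_ne_zero)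
    (((dvd_pow (Int.natCast_dvd_natCast.2 h) two_ne_zero)).mul_left _)

theorem not_dvd_fib_of_dvd_lucas (hp : p.Prime) (hp2 : p ≠ 2) {n : ℕ} (h : p ∣ lucas n) :
    ¬ p ∣ Nat.fib n := fun h' =>
  not_dvd_lucas_of_dvd_fib hp hp2 h' (Int.natCast_dvd_natCast.2 h)

theorem padicValNat_fib_mul_of_le_one (hp : p.Prime) (hp2 : p ≠ 2) {d k : ℕ} (hd : d ≠ 0)
    (hk : k ≠ 0) (h : p ∣ Nat.fib d) (hv : padicValNat p k ≤ 1) :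
    padicValNat p (Nat.fib (d * k)) = padicValNat p (Nat.fib d) + padicValNat p k := by
  have : Fact p.Prime := ⟨hp⟩
  have hpi := Nat.prime_iff_prime_int.1 hp
  have hF : Nat.fib d ≠ 0 := by simpa using hd
  have hFk : Nat.fib (d * k) ≠ 0 := by simp [hd, hk]
  have ha : 1 ≤ padicValNat p (Nat.fib d) := one_le_padicValNat_of_dvd hF h
  have key : ∀ {n : ℕ}, n ≠ 0 → ∃ u : ℕ, n = p ^ padicValNat p n * u ∧ ¬ (p : ℤ) ∣ u := by
    intro n hn
    obtain ⟨u, hu⟩ := pow_padicValNat_dvd (p := p) (n := n)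
    refine ⟨u, hu, fun hdvd => pow_succ_padicValNat_not_dvd (p := p) hn ?_⟩
    obtain ⟨t, rfl⟩ := Int.natCast_dvd_natCast.1 hdvd
    exact ⟨t, by rw [pow_succ, mul_assoc, ← hu]⟩
  obtain ⟨u, hu, hu'⟩ := key hF
  obtain ⟨w, hw, hw'⟩ := key hk
  obtain ⟨x, hx, hx'⟩ := key hFk
  generalize padicValNat p (Nat.fib d) = a at *
  generalize padicValNat p k = b at *
  generalize padicValNat p (Nat.fib (d * k)) = r at *
  obtain ⟨k', rfl⟩ := Nat.exists_eq_succ_of_ne_zero hk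
  obtain ⟨⟨c, hc⟩, -⟩ := exists_fib_mul_expansion d k'
  have hL := not_dvd_lucas_of_dvd_fib hp hp2 h
  obtain ⟨s, hs⟩ : ∃ s, a + a = b + s + 1 := ⟨a + a - b - 1, by omega⟩
  have hu2 : (Nat.fib d : ℤ) = p ^ a * u := by exact_mod_cast hu
  have hw2 : ((k' : ℤ) + 1) = p ^ b * w := by exact_mod_cast hw
  have hx2 : (Nat.fib (d * (k' + 1)) : ℤ) = p ^ r * x := by exact_mod_cast hx
  rw [hu2, hw2, hx2] at hc
  have hpp : (p : ℤ) ^ a * p ^ a = p ^ b * p ^ s * p := by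
    rw [← pow_add, hs, pow_add, pow_add, pow_one]
  set t : ℤ := w * u * lucas d ^ k' + p * (p ^ s * u ^ 3 * c) with ht
  have ht' : ¬ (p : ℤ) ∣ t := by
    rw [ht, dvd_add_left (dvd_mul_right _ _)]
    intro hdvd
    rcases hpi.dvd_or_dvd hdvd with hdvd | hdvd
    · exact (hpi.dvd_or_dvd hdvd).elim hw' hu'
    · exact hL (hpi.dvd_of_dvd_pow hdvd)
  have hx3 : ¬ (p : ℤ) ∣ 2 ^ k' * x := by
    intro hdvd
    exact (hpi.dvd_or_dvd hdvd).elim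
      (fun h => not_dvd_two hp hp2 (hpi.dvd_of_dvd_pow h)) hx'
  have heq : (p : ℤ) ^ r * (2 ^ k' * x) = p ^ (a + b) * t := by
    rw [ht, pow_add]
    linear_combination hc + (p : ℤ) ^ a * u ^ 3 * c * hpp
  have hp0 : (p : ℤ) ≠ 0 := hpi.ne_zero
  rcases lt_trichotomy r (a + b) with hlt | hlt | hlt
  · obtain ⟨j, hj⟩ := Nat.exists_eq_add_of_lt hlt
    exfalso
    apply hx3
    refine ⟨p ^ j * t, mul_left_cancel₀ (pow_ne_zero r hp0) ?_⟩
    rw [heq, hj]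
    ring
  · exact hlt
  · obtain ⟨j, hj⟩ := Nat.exists_eq_add_of_lt hlt
    exfalso
    apply ht'
    refine ⟨p ^ j * (2 ^ k' * x), mul_left_cancel₀ (pow_ne_zero (a + b) hp0) ?_⟩
    rw [← heq, hj]
    ring

/-- Lifting the exponent for Fibonacci numbers. -/
theorem padicValNat_fib_mul (hp : p.Prime) (hp2 : p ≠ 2) {d k : ℕ} (hd : d ≠ 0)
    (hk : k ≠ 0) (h : p ∣ Nat.fib d) :
    padicValNat p (Nat.fib (d * k)) = padicValNat p (Nat.fib d) + padicValNat p k := by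
  have : Fact p.Prime := ⟨hp⟩
  induction k using Nat.strong_induction_on generalizing d with
  | _ k ih =>
    by_cases hpk : p ∣ k
    · obtain ⟨m, rfl⟩ := hpk
      have hm : m ≠ 0 := by rintro rfl; simp at hk
      have hdp : p ∣ Nat.fib (d * p) := h.trans (Nat.fib_dvd _ _ (dvd_mul_right _ _))
      rw [← mul_assoc, ih m (lt_mul_left (Nat.pos_of_ne_zero hm) hp.one_lt)
        (mul_ne_zero hd hp.ne_zero) hm hdp,
        padicValNat_fib_mul_of_le_one hp hp2 hd hp.ne_zero h (by simp),
        padicValNat.mul hp.ne_zero hm, add_assoc]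
    · exact padicValNat_fib_mul_of_le_one hp hp2 hd hk h
        (by rw [padicValNat.eq_zero_of_not_dvd hpk]; exact zero_le_one)

theorem binet_lucas_fib {K : Type*} [Field K] (h2 : (2 : K) ≠ 0) {r : K} (hr : r ^ 2 = 5) (n : ℕ) :
    2 * ((1 + r) / 2) ^ n = (lucas n : K) + r * Nat.fib n := by
  induction n with
  | zero => simp [lucas]
  | succ n ih =>
    have e1 := congrArg (Int.cast : ℤ → K) (two_mul_lucas_add n 1)
    have e2 := congrArg (Int.cast : ℤ → K) (two_mul_fib_add n 1)
    simp only [lucas, Nat.fib_one] at e1 e2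
    push_cast at e1 e2
    have e3 : 2 * ((1 + r) / 2) = 1 + r := mul_div_cancel₀ _ h2
    apply mul_left_cancel₀ h2
    rw [pow_succ]
    linear_combination 2 * ((1 + r) / 2) * ih + (lucas n + r * Nat.fib n : K) * e3 - e1 - r * e2
      + (Nat.fib n : K) * hr

theorem fib_lucas_prime_of_sq_eq_five {K : Type*} [Field K] (hp : p.Prime) [CharP K p]
    (h2 : (2 : K) ≠ 0) (h5 : (5 : K) ≠ 0) {r : K} (hr : r ^ 2 = 5) :
    (Nat.fib p : K) = 5 ^ (p / 2) ∧ (lucas p : K) = 1 := by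
  have : Fact p.Prime := ⟨hp⟩
  have hr0 : r ≠ 0 := by
    rintro rfl
    exact h5 (by rw [← hr]; simp)
  have b1 := binet_lucas_fib h2 hr p
  have b2 := binet_lucas_fib h2 (r := -r) (by rw [neg_sq, hr]) p
  have hsum : ((1 + r) / 2) ^ p + ((1 + -r) / 2) ^ p = 1 := by
    rw [← add_pow_char, ← add_div, add_add_add_comm, add_neg_cancel, add_zero, one_add_one_eq_two,
      div_self h2, one_pow]
  have hsub : ((1 + r) / 2) ^ p - ((1 + -r) / 2) ^ p = r ^ p := by
    rw [← sub_pow_char]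
    congr 1
    field_simp
    ring
  have hp2 : p ≠ 2 := by
    rintro rfl
    exact h2 (by exact_mod_cast CharP.cast_eq_zero K 2)
  have hrp : r ^ p = r * 5 ^ (p / 2) := by
    have hodd := Nat.two_mul_div_two_add_one_of_odd (hp.odd_of_ne_two hp2)
    calc r ^ p = r ^ (2 * (p / 2) + 1) := by rw [hodd]
      _ = r * 5 ^ (p / 2) := by rw [pow_succ, pow_mul, hr, mul_comm]
  constructor
  · apply mul_left_cancel₀ (mul_ne_zero h2 hr0)
    linear_combination b2 - b1 + 2 * hsub + 2 * hrp
  · apply mul_left_cancel₀ h2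
    linear_combination 2 * hsum - b1 - b2

theorem natCast_prime_ne_zero (K : Type*) [Ring K] [CharP K p] (hp : p.Prime) {q : ℕ}
    (hq : q.Prime) (h : p ≠ q) : (q : K) ≠ 0 := by
  rw [Ne, CharP.cast_eq_zero_iff K p, Nat.prime_dvd_prime_iff_eq hp hq]
  exact h

/-- `F p` is the Legendre symbol of `5` modulo `p`, and `L p` is `1`. -/
theorem fib_lucas_prime (hp : p.Prime) (hp2 : p ≠ 2) (hp5 : p ≠ 5) :
    (Nat.fib p : ZMod p) = 5 ^ (p / 2) ∧ (lucas p : ZMod p) = 1 := by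
  have : Fact p.Prime := ⟨hp⟩
  obtain ⟨r, hr⟩ := IsAlgClosed.exists_pow_nat_eq (5 : AlgebraicClosure (ZMod p)) (n := 2) two_pos
  obtain ⟨h1, h2⟩ := fib_lucas_prime_of_sq_eq_five hp
    (by exact_mod_cast natCast_prime_ne_zero (AlgebraicClosure (ZMod p)) hp Nat.prime_two hp2)
    (by exact_mod_cast natCast_prime_ne_zero (AlgebraicClosure (ZMod p)) hp Nat.prime_five hp5) hr
  have inj := (algebraMap (ZMod p) (AlgebraicClosure (ZMod p))).injective
  exact ⟨inj (by rw [map_natCast, map_pow, map_ofNat]; exact h1), inj (by simpa using h2)⟩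

theorem legendreSym_five_natCast {s : ℕ} (h0 : 0 < s) (h : s < 5) :
    @legendreSym 5 ⟨Nat.prime_five⟩ s = if s = 1 ∨ s = 4 then 1 else -1 := by
  interval_cases s <;> decide

theorem five_pow_eq (hp : p.Prime) (hp2 : p ≠ 2) (hp5 : p ≠ 5) :
    (5 : ZMod p) ^ (p / 2) = if p % 5 = 1 ∨ p % 5 = 4 then 1 else -1 := by
  have : Fact p.Prime := ⟨hp⟩
  have : Fact (Nat.Prime 5) := ⟨Nat.prime_five⟩
  have h1 := legendreSym.eq_pow p 5
  have h2 := legendreSym.quadratic_reciprocity_one_mod_four (p := 5) (q := p) rfl hp2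
  have h3 := legendreSym.mod 5 p
  have h0 : p % 5 ≠ 0 := fun h =>
    hp5 ((Nat.prime_dvd_prime_iff_eq Nat.prime_five hp).1 (Nat.dvd_of_mod_eq_zero h)).symm
  have h4 : p % 5 < 5 := Nat.mod_lt _ (by norm_num)
  push_cast at h1 h2 h3
  have h5 : ((p : ℤ) % 5) = ((p % 5 : ℕ) : ℤ) := by push_cast; rfl
  rw [← h1, h2, h3, h5, legendreSym_five_natCast (Nat.pos_of_ne_zero h0) h4]
  split_ifs <;> simp

theorem dvd_fib_pSubEps (hp : p.Prime) (hp2 : p ≠ 2) (hp5 : p ≠ 5) :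
    p ∣ Nat.fib (pSubEps p) := by
  obtain ⟨hF, hL⟩ := fib_lucas_prime hp hp2 hp5
  rw [five_pow_eq hp hp2 hp5] at hF
  have hLF := congrArg (Int.cast : ℤ → ZMod p) (lucas_cast p)
  push_cast at hLF
  rw [hL] at hLF
  have : Fact p.Prime := ⟨hp⟩
  have h2 : (2 : ZMod p) ≠ 0 := by exact_mod_cast natCast_prime_ne_zero (ZMod p) hp Nat.prime_two hp2
  rw [← ZMod.natCast_eq_zero_iff]
  apply mul_left_cancel₀ h2
  unfold pSubEps
  split_ifs at hF ⊢ with h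
  · obtain ⟨q, rfl⟩ := Nat.exists_eq_succ_of_ne_zero hp.ne_zero
    have := Nat.fib_add_two (n := q)
    have := congrArg (Nat.cast : ℕ → ZMod (q + 1)) this
    push_cast at this
    simp only [Nat.succ_eq_add_one, Nat.add_sub_cancel] at *
    linear_combination -hLF - 2 * this - hF
  · linear_combination -hLF + hF

theorem not_dvd_pSubEps (hp : p.Prime) : ¬ p ∣ pSubEps p := by
  have h1 := hp.one_lt
  intro h
  unfold pSubEps at h
  split_ifs at h
  · exact absurd (Nat.le_of_dvd (by omega) h) (by omega)
  · exact hp.one_lt.ne' (Nat.dvd_one.1 ((Nat.dvd_add_right dvd_rfl).1 h))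

theorem pSubEps_ne_zero (hp : p.Prime) : pSubEps p ≠ 0 := fun h =>
  not_dvd_pSubEps hp (h ▸ dvd_zero p)

theorem one_le_wallExp (hp : p.Prime) (hp2 : p ≠ 2) (hp5 : p ≠ 5) : 1 ≤ wallExp p := by
  have : Fact p.Prime := ⟨hp⟩
  exact one_le_padicValNat_of_dvd (by simpa using pSubEps_ne_zero hp)
    (dvd_fib_pSubEps hp hp2 hp5)

theorem exists_padicValNat_fib_eq (hp : p.Prime) (hp2 : p ≠ 2) (hp5 : p ≠ 5) {n : ℕ}
    (hn : n ≠ 0) (h : p ∣ Nat.fib n) :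
    ∃ a, a ∣ n ∧ padicValNat p (Nat.fib n) = wallExp p + padicValNat p a := by
  have hd := pSubEps_ne_zero hp
  have hg : p ∣ Nat.fib (n.gcd (pSubEps p)) := by
    rw [Nat.fib_gcd]
    exact Nat.dvd_gcd h (dvd_fib_pSubEps hp hp2 hp5)
  have hg0 : n.gcd (pSubEps p) ≠ 0 := Nat.gcd_ne_zero_left hn
  obtain ⟨a, ha⟩ := Nat.gcd_dvd_left n (pSubEps p)
  obtain ⟨b, hb⟩ := Nat.gcd_dvd_right n (pSubEps p)
  have ha0 : a ≠ 0 := by rintro rfl; exact hn (by simpa using ha)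
  have hb0 : b ≠ 0 := by rintro rfl; exact hd (by simpa using hb)
  have hbp : ¬ p ∣ b := fun hdvd => not_dvd_pSubEps hp (hb ▸ hdvd.mul_left _)
  refine ⟨a, ⟨_, by rw [mul_comm]; exact ha⟩, ?_⟩
  have h1 := padicValNat_fib_mul hp hp2 hg0 ha0 hg
  have h2 := padicValNat_fib_mul hp hp2 hg0 hb0 hg
  rw [← ha] at h1
  rw [← hb, padicValNat.eq_zero_of_not_dvd hbp, add_zero] at h2
  rw [h1, wallExp, h2]

theorem pow_wallExp_dvd_fib (hp : p.Prime) (hp2 : p ≠ 2) (hp5 : p ≠ 5) {n : ℕ}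
    (h : p ∣ Nat.fib n) : p ^ wallExp p ∣ Nat.fib n := by
  have : Fact p.Prime := ⟨hp⟩
  rcases eq_or_ne n 0 with rfl | hn
  · simp
  obtain ⟨a, -, ha⟩ := exists_padicValNat_fib_eq hp hp2 hp5 hn h
  rw [padicValNat_dvd_iff_le (by simpa using hn), ha]
  exact Nat.le_add_right _ _

theorem pow_wallExp_dvd_lucas (hp : p.Prime) (hp2 : p ≠ 2) (hp5 : p ≠ 5) {n : ℕ}
    (h : p ∣ lucas n) : p ^ wallExp p ∣ lucas n := by
  have h1 : p ^ wallExp p ∣ Nat.fib (2 * n) :=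
    pow_wallExp_dvd_fib hp hp2 hp5 (fib_two_mul_eq n ▸ h.mul_left _)
  rw [fib_two_mul_eq] at h1
  exact (Nat.Coprime.pow_left _
    ((Nat.Prime.coprime_iff_not_dvd hp).2 (not_dvd_fib_of_dvd_lucas hp hp2 h))).dvd_of_dvd_mul_left h1

theorem fib_add_four_mul (hp : p.Prime) (hp2 : p ≠ 2) {d : ℕ} (h : p ∣ Nat.fib d) (n : ℕ) :
    (Nat.fib (n + 4 * d) : ZMod p) = Nat.fib n := by
  have : Fact p.Prime := ⟨hp⟩
  have h0 : (Nat.fib d : ZMod p) = 0 := (ZMod.natCast_eq_zero_iff _ _).2 h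
  have step : ∀ n, (Nat.fib (n + d) : ZMod p) = Nat.fib n * Nat.fib (d + 1) := by
    intro n
    have := congrArg (Int.cast : ℤ → ZMod p) (fib_add_cast n d)
    push_cast at this
    rw [this, h0]
    ring
  have h2 : (2 : ZMod p) ≠ 0 := by
    exact_mod_cast natCast_prime_ne_zero (ZMod p) hp Nat.prime_two hp2
  have hsq := congrArg (Int.cast : ℤ → ZMod p) (lucas_sq_sub d)
  rw [lucas_cast] at hsq
  push_cast at hsq
  rw [h0] at hsq
  have hx : (Nat.fib (d + 1) : ZMod p) ^ 2 = (-1) ^ d := by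
    apply mul_left_cancel₀ (pow_ne_zero 2 h2)
    linear_combination hsq
  have hx4 : (Nat.fib (d + 1) : ZMod p) ^ 4 = 1 := by
    rw [show 4 = 2 * 2 from rfl, pow_mul, hx, ← pow_mul, mul_comm, pow_mul]
    simp
  rw [show n + 4 * d = n + d + d + d + d by ring, step, step, step, step]
  linear_combination (Nat.fib n : ZMod p) * hx4

theorem pisano_mem (hp : p.Prime) (hp2 : p ≠ 2) (hp5 : p ≠ 5) :
    1 ≤ pisano p ∧ ∀ n, Nat.fib (n + pisano p) ≡ Nat.fib n [MOD p] := by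
  refine Nat.sInf_mem (s := {m | 1 ≤ m ∧ ∀ n, Nat.fib (n + m) ≡ Nat.fib n [MOD p]})
    ⟨4 * pSubEps p, ?_, fun n => ?_⟩
  · have := pSubEps_ne_zero hp
    omega
  · rw [← ZMod.natCast_eq_natCast_iff]
    exact fib_add_four_mul hp hp2 (dvd_fib_pSubEps hp hp2 hp5) n

theorem fib_add_pisano_mul (hp : p.Prime) (hp2 : p ≠ 2) (hp5 : p ≠ 5) (n k : ℕ) :
    Nat.fib (n + pisano p * k) ≡ Nat.fib n [MOD p] := by
  induction k with
  | zero => rfl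
  | succ k ih =>
    rw [mul_add_one, ← add_assoc]
    exact ((pisano_mem hp hp2 hp5).2 _).trans ih

theorem pisano_dvd (hp : p.Prime) (hp2 : p ≠ 2) (hp5 : p ≠ 5) {m : ℕ}
    (h : ∀ n, Nat.fib (n + m) ≡ Nat.fib n [MOD p]) : pisano p ∣ m := by
  by_contra hdvd
  have hlt : m % pisano p < pisano p := Nat.mod_lt _ (pisano_mem hp hp2 hp5).1
  refine Nat.notMem_of_lt_sInf hlt ⟨Nat.one_le_iff_ne_zero.2 fun h0 =>
    hdvd (Nat.dvd_of_mod_eq_zero h0), fun n => ?_⟩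
  have h1 := fib_add_pisano_mul hp hp2 hp5 (n + m % pisano p) (m / pisano p)
  rw [add_assoc, Nat.mod_add_div] at h1
  exact h1.symm.trans (h n)

theorem not_dvd_pisano (hp : p.Prime) (hp2 : p ≠ 2) (hp5 : p ≠ 5) : ¬ p ∣ pisano p := by
  intro h
  have h1 : pisano p ∣ 4 * pSubEps p := pisano_dvd hp hp2 hp5 fun n =>
    (ZMod.natCast_eq_natCast_iff _ _ _).1
      (fib_add_four_mul hp hp2 (dvd_fib_pSubEps hp hp2 hp5) n)
  rcases hp.dvd_mul.1 (h.trans h1) with h2 | h2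
  · exact hp2 ((Nat.prime_dvd_prime_iff_eq hp Nat.prime_two).1
      (hp.dvd_of_dvd_pow (n := 2) h2))
  · exact not_dvd_pSubEps hp h2

theorem dvd_fib_of_period {s : ℕ} (h : ∀ n, Nat.fib (n + s) ≡ Nat.fib n [MOD p]) :
    p ∣ Nat.fib s := by
  have := h 0
  rw [zero_add] at this
  exact (Nat.modEq_zero_iff_dvd.1 this)

theorem pow_dvd_fib_pisano_mul_iff (hp : p.Prime) (hp2 : p ≠ 2) (hp5 : p ≠ 5) (j k : ℕ) :
    p ^ (wallExp p + j) ∣ Nat.fib (pisano p * k) ↔ p ^ j ∣ k := by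
  have : Fact p.Prime := ⟨hp⟩
  rcases eq_or_ne k 0 with rfl | hk
  · simp
  have hπ := pisano_mem hp hp2 hp5
  have hπ0 : pisano p ≠ 0 := Nat.one_le_iff_ne_zero.1 hπ.1
  have hdvd := dvd_fib_of_period hπ.2
  obtain ⟨a, ha, hva⟩ := exists_padicValNat_fib_eq hp hp2 hp5 hπ0 hdvd
  rw [padicValNat.eq_zero_of_not_dvd fun h => not_dvd_pisano hp hp2 hp5 (h.trans ha)] at hva
  rw [padicValNat_dvd_iff_le (by simp [hk, hπ0]), padicValNat_dvd_iff_le hk,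
    padicValNat_fib_mul hp hp2 hπ0 hk hdvd, hva]
  omega

theorem lucas_add_period {s : ℕ} (hs : ∀ n, Nat.fib (n + s) ≡ Nat.fib n [MOD p])
    (m : ℕ) : (p : ℤ) ∣ lucas (m + s) - lucas m := by
  rw [lucas_cast, lucas_cast, add_right_comm]
  have h1 := (Nat.modEq_iff_dvd.1 (hs m).symm)
  have h2 := (Nat.modEq_iff_dvd.1 (hs (m + 1)).symm)
  have := dvd_sub (h2.mul_left 2) h1
  exact this.trans (dvd_of_eq (by ring))

theorem neg_one_pow_period {s : ℕ} (hs : ∀ n, Nat.fib (n + s) ≡ Nat.fib n [MOD p])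
    (hp : p.Prime) (hp2 : p ≠ 2) : (-1 : ℤ) ^ s = 1 := by
  rcases neg_one_pow_eq_or ℤ s with h | h
  · exact h
  exfalso
  have h1 := lucas_sq_sub s
  have h2 := lucas_add_period hs 0
  have h3 : (p : ℤ) ∣ Nat.fib s := Int.natCast_dvd_natCast.2 (dvd_fib_of_period hs)
  rw [zero_add] at h2
  have h8 : (p : ℤ) ∣ 2 ^ 3 := by
    have := dvd_sub (h3.mul_left (5 * Nat.fib s)) (h2.mul_right ((lucas s : ℤ) + 2))
    refine this.trans (dvd_of_eq ?_)
    rw [h] at h1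
    simp only [lucas]
    push_cast
    linear_combination -h1
  exact not_dvd_two hp hp2 ((Nat.prime_iff_prime_int.1 hp).dvd_of_dvd_pow h8)

theorem pow_dvd_lucas_add_sub_iff
    {s : ℕ} (hs : ∀ n, Nat.fib (n + s) ≡ Nat.fib n [MOD p])
    (hp : p.Prime) (hp2 : p ≠ 2) (hp5 : p ≠ 5) {m : ℕ}
    (hm : p ∣ lucas m) (N : ℕ) :
    (p : ℤ) ^ N ∣ lucas (m + s) - lucas m ↔ p ^ N ∣ Nat.fib s := by
  have hpi := Nat.prime_iff_prime_int.1 hp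
  have hF : (p : ℤ) ∣ Nat.fib s := Int.natCast_dvd_natCast.2 (dvd_fib_of_period hs)
  have hm' : (p : ℤ) ∣ lucas m := Int.natCast_dvd_natCast.2 hm
  have hFm : ¬ (p : ℤ) ∣ Nat.fib m := fun h =>
    not_dvd_fib_of_dvd_lucas hp hp2 hm (Int.natCast_dvd_natCast.1 h)
  have hL : ¬ (p : ℤ) ∣ lucas s + 2 := by
    intro h
    have h0 := lucas_add_period hs 0
    rw [zero_add] at h0
    have := dvd_sub h h0
    simp only [lucas] at this
    push_cast at this
    apply not_dvd_four_mul_neg_one_pow hp hp2 0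
    exact this.trans (dvd_of_eq (by ring))
  have key : 2 * ((lucas s : ℤ) + 2) * (lucas (m + s) - lucas m) =
      5 * (lucas m * Nat.fib s + Nat.fib m * (lucas s + 2)) * Nat.fib s := by
    have h1 := two_mul_lucas_add m s
    have h2 := lucas_sq_sub s
    rw [neg_one_pow_period hs hp hp2] at h2
    linear_combination ((lucas s : ℤ) + 2) * h1 + (lucas m : ℤ) * h2
  have c1 : IsCoprime ((p : ℤ) ^ N) (2 * (lucas s + 2)) :=
    IsCoprime.pow_left ((Prime.coprime_iff_not_dvd hpi).2 fun h =>
      (hpi.dvd_or_dvd h).elim (not_dvd_two hp hp2) hL)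
  have c2 : IsCoprime ((p : ℤ) ^ N)
      (5 * (lucas m * Nat.fib s + Nat.fib m * (lucas s + 2))) := by
    refine IsCoprime.pow_left ((Prime.coprime_iff_not_dvd hpi).2 fun h => ?_)
    rcases hpi.dvd_or_dvd h with h | h
    · exact not_dvd_five hp hp5 h
    · rw [dvd_add_right (hm'.mul_right _)] at h
      exact (hpi.dvd_or_dvd h).elim hFm hL
  rw [← Int.natCast_dvd_natCast, Nat.cast_pow]
  constructor
  · exact fun h => c2.dvd_of_dvd_mul_left (key ▸ h.mul_left _)
  · exact fun h => c1.dvd_of_dvd_mul_left (key.symm ▸ h.mul_left _)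

theorem pow_dvd_fib_add_sub_iff
    {s : ℕ} (hs : ∀ n, Nat.fib (n + s) ≡ Nat.fib n [MOD p])
    (hp : p.Prime) (hp2 : p ≠ 2) (hp5 : p ≠ 5) {m : ℕ}
    (hm : p ∣ lucas m) (N : ℕ) :
    (p : ℤ) ^ N ∣ Nat.fib (m + s) - Nat.fib m ↔
      (p : ℤ) ^ N ∣ (lucas (m + s) : ℤ) ^ 2 - (lucas m : ℤ) ^ 2 := by
  have hpi := Nat.prime_iff_prime_int.1 hp
  have hFm : ¬ (p : ℤ) ∣ Nat.fib m := fun h =>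
    not_dvd_fib_of_dvd_lucas hp hp2 hm (Int.natCast_dvd_natCast.1 h)
  have key : (lucas (m + s) : ℤ) ^ 2 - (lucas m : ℤ) ^ 2 =
      5 * (Nat.fib (m + s) + Nat.fib m) * (Nat.fib (m + s) - Nat.fib m) := by
    have h1 := lucas_sq_sub m
    have h2 := lucas_sq_sub (m + s)
    rw [pow_add, neg_one_pow_period hs hp hp2] at h2
    linear_combination h2 - h1
  have c : IsCoprime ((p : ℤ) ^ N) (5 * (Nat.fib (m + s) + Nat.fib m)) := by
    refine IsCoprime.pow_left ((Prime.coprime_iff_not_dvd hpi).2 fun h => ?_)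
    rcases hpi.dvd_or_dvd h with h | h
    · exact not_dvd_five hp hp5 h
    · have h1 := dvd_sub h (Nat.modEq_iff_dvd.1 (hs m).symm)
      have h2 : (p : ℤ) ∣ 2 * Nat.fib m := h1.trans (dvd_of_eq (by ring))
      exact (hpi.dvd_or_dvd h2).elim (not_dvd_two hp hp2) hFm
  rw [key]
  exact ⟨fun h => h.mul_left _, c.dvd_of_dvd_mul_left⟩

theorem natCard_range_congr {ι α β : Type*} {f : ι → α} {g : ι → β}
    (h : ∀ x y, f x = f y ↔ g x = g y) : Nat.card (Set.range f) = Nat.card (Set.range g) := by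
  have : Setoid.ker f = Setoid.ker g := Setoid.ext h
  exact Nat.card_congr ((Setoid.quotientKerEquivRange f).symm.trans
    ((Quotient.congrRight fun x y => h x y).trans (Setoid.quotientKerEquivRange g)))

/-- The number of squares modulo `p ^ m`. -/
noncomputable def sqCount (p m : ℕ) : ℕ := Nat.card (Set.range fun y : ZMod (p ^ m) => y ^ 2)

theorem natCard_range_sq_of_surjective {ι : Type*} {m : ℕ} {f : ι → ZMod (p ^ m)}
    (hf : Function.Surjective f) : Nat.card (Set.range fun k => f k ^ 2) = sqCount p m := by
  rw [sqCount, ← hf.range_comp fun y : ZMod (p ^ m) => y ^ 2]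
  rfl

theorem two_mul_natCard_range_unit_sq (hp : p.Prime) (hp2 : p ≠ 2) (m : ℕ) :
    2 * Nat.card (Set.range fun u : (ZMod (p ^ (m + 1)))ˣ => (u : ZMod (p ^ (m + 1))) ^ 2) =
      p ^ m * (p - 1) := by
  have : NeZero (p ^ (m + 1)) := ⟨pow_ne_zero _ hp.ne_zero⟩
  have := ZMod.isCyclic_units_of_prime_pow p hp hp2 (m + 1)
  have hcard : Nat.card (ZMod (p ^ (m + 1)))ˣ = p ^ m * (p - 1) := by
    rw [Nat.card_eq_fintype_card, ZMod.card_units_eq_totient, Nat.totient_prime_pow_succ hp]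
  have h1 := (powMonoidHom 2 : (ZMod (p ^ (m + 1)))ˣ →* _).range.card_mul_index
  rw [IsCyclic.index_powMonoidHom_range, hcard, Nat.gcd_eq_right] at h1
  · rw [← h1, mul_comm]
    congr 1
    refine natCard_range_congr (g := powMonoidHom 2) fun x y => ?_
    simp [← Units.val_inj]
  · exact (even_iff_two_dvd.1 (hp.even_sub_one hp2)).mul_left _

theorem pow_dvd_pow_mul_iff (hp : p.Prime) (a b : ℕ) (x : ℤ) :
    (p : ℤ) ^ (a + b) ∣ (p : ℤ) ^ a * x ↔ (p : ℤ) ^ b ∣ x := by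
  rw [pow_add]
  exact mul_dvd_mul_iff_left (pow_ne_zero _ (Int.natCast_ne_zero.2 hp.ne_zero))

theorem intCast_zmod_pow_eq_iff (m : ℕ) (x y : ℤ) :
    (x : ZMod (p ^ m)) = y ↔ (p : ℤ) ^ m ∣ x - y := by
  rw [← sub_eq_zero, ← Int.cast_sub, ZMod.intCast_zmod_eq_zero_iff_dvd, Nat.cast_pow]

theorem natCard_range_prime_mul_sq (hp : p.Prime) (m : ℕ) :
    Nat.card (Set.range fun k : ℕ => ((p * k : ZMod (p ^ (m + 2)))) ^ 2) = sqCount p m := by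
  have : NeZero (p ^ m) := ⟨pow_ne_zero _ hp.ne_zero⟩
  rw [← natCard_range_sq_of_surjective (p := p) (m := m) (ZMod.natCast_zmod_surjective)]
  refine natCard_range_congr fun x y => ?_
  have h1 := intCast_zmod_pow_eq_iff (p := p) (m + 2) ((p * x) ^ 2) ((p * y) ^ 2)
  have h2 := intCast_zmod_pow_eq_iff (p := p) m (x ^ 2) (y ^ 2)
  push_cast at h1 h2
  rw [h1, h2, ← pow_dvd_pow_mul_iff hp 2 m, add_comm m 2]
  ring_nf

theorem two_mul_sqCount_add_two (hp : p.Prime) (hp2 : p ≠ 2) (m : ℕ) :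
    2 * sqCount p (m + 2) = p ^ (m + 1) * (p - 1) + 2 * sqCount p m := by
  have : NeZero (p ^ (m + 2)) := ⟨pow_ne_zero _ hp.ne_zero⟩
  rw [← two_mul_natCard_range_unit_sq hp hp2 (m + 1), ← natCard_range_prime_mul_sq hp m,
    ← mul_add, Nat.card_coe_set_eq, Nat.card_coe_set_eq, ← Set.ncard_union_eq ?_
      (Set.toFinite _) (Set.toFinite _), sqCount, Nat.card_coe_set_eq]
  · congr 2
    ext z
    constructor
    · rintro ⟨y, rfl⟩
      by_cases hy : IsUnit y
      · obtain ⟨u, rfl⟩ := hy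
        exact Or.inl ⟨u, rfl⟩
      · right
        rw [← ZMod.natCast_zmod_val y, ZMod.isUnit_iff_coprime,
          Nat.coprime_pow_right_iff (by omega), Nat.coprime_comm,
          Nat.Prime.coprime_iff_not_dvd hp, not_not] at hy
        obtain ⟨k, hk⟩ := hy
        refine ⟨k, ?_⟩
        dsimp only
        rw [← Nat.cast_mul, ← hk, ZMod.natCast_zmod_val]
    · rintro (⟨u, rfl⟩ | ⟨k, rfl⟩)
      · exact ⟨u, rfl⟩
      · exact ⟨p * k, rfl⟩
  · rw [Set.disjoint_left]
    rintro _ ⟨u, rfl⟩ ⟨k, hk⟩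
    have h1 : IsUnit ((p * k : ZMod (p ^ (m + 2))) ^ 2) := by
      rw [show (p * k : ZMod (p ^ (m + 2))) ^ 2 = u ^ 2 from hk]
      exact u.isUnit.pow 2
    rw [isUnit_pow_iff two_ne_zero, ← Nat.cast_mul, ZMod.isUnit_iff_coprime,
      Nat.coprime_pow_right_iff (by omega), Nat.coprime_comm,
      Nat.Prime.coprime_iff_not_dvd hp] at h1
    exact h1 (dvd_mul_right _ _)

theorem tendsto_sqCount_div (hp : p.Prime) (hp2 : p ≠ 2) :
    Filter.Tendsto (fun m : ℕ => (sqCount p m : ℝ) / (p : ℝ) ^ m) Filter.atTop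
      (nhds (p / (2 * (p + 1)))) := by
  have hp0 : (0 : ℝ) < p := by exact_mod_cast hp.pos
  have hp1 : (1 : ℝ) < p := by exact_mod_cast hp.one_lt
  set c : ℝ := p / (2 * (p + 1)) with hc
  set D : ℕ → ℝ := fun m => sqCount p m - c * p ^ m with hD
  have hper : ∀ m, D (m + 2) = D m := by
    intro m
    have h := congrArg (Nat.cast : ℕ → ℝ) (two_mul_sqCount_add_two hp hp2 m)
    push_cast [hp.one_le] at h
    have hc' : c * (2 * (p + 1)) = p := div_mul_cancel₀ _ (by positivity)
    simp only [hD]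
    linear_combination h / 2 - (p - 1) * p ^ m / 2 * hc'
  have hbd : ∀ m, |D m| ≤ |D 0| + |D 1| := by
    intro m
    induction m using Nat.twoStepInduction with
    | zero => simp
    | one => simp
    | more n h _ => rwa [hper]
  have hlim : Filter.Tendsto (fun m : ℕ => D m * ((p : ℝ) ^ m)⁻¹) Filter.atTop (nhds 0) := by
    refine bdd_le_mul_tendsto_zero' (|D 0| + |D 1|) (Filter.Eventually.of_forall hbd) ?_
    exact tendsto_inv_atTop_zero.comp (tendsto_pow_atTop_atTop_of_one_lt hp1)
  have := hlim.const_add c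
  rw [add_zero] at this
  refine this.congr fun m => ?_
  simp only [hD]
  field_simp
  ring

theorem natCard_fib_residues (hp : p.Prime) (hp2 : p ≠ 2) (hp5 : p ≠ 5) {i : ℕ}
    (hi : i < pisano p) (hL : p ∣ lucas i) (j : ℕ) :
    Nat.card {x : ZMod (p ^ (2 * wallExp p + j)) |
      ∃ n : ℕ, n % pisano p = i ∧ (Nat.fib n : ZMod (p ^ (2 * wallExp p + j))) = x} =
      sqCount p j := by
  have : NeZero (p ^ j) := ⟨pow_ne_zero _ hp.ne_zero⟩
  have hp0 : (p : ℤ) ^ wallExp p ≠ 0 := pow_ne_zero _ (Int.natCast_ne_zero.2 hp.ne_zero)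
  have hL' : ∀ k, p ∣ lucas (i + pisano p * k) := fun k => by
    have := lucas_add_period (fun n => fib_add_pisano_mul hp hp2 hp5 n k) i
    rw [dvd_sub_left (Int.natCast_dvd_natCast.2 hL)] at this
    exact Int.natCast_dvd_natCast.1 this
  choose l hl using fun k => pow_wallExp_dvd_lucas hp hp2 hp5 (hL' k)
  have hlz : ∀ k, (lucas (i + pisano p * k) : ℤ) = p ^ wallExp p * l k := fun k => by
    exact_mod_cast hl k
  have hdiff : ∀ x t, ((l (x + t) : ZMod (p ^ j)) = l x ↔ p ^ j ∣ t) := fun x t => by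
    have h := pow_dvd_lucas_add_sub_iff (fun n => fib_add_pisano_mul hp hp2 hp5 n t) hp hp2 hp5
      (hL' x) (wallExp p + j)
    rw [add_assoc, ← mul_add, hlz, hlz, ← mul_sub, pow_dvd_pow_mul_iff hp,
      pow_dvd_fib_pisano_mul_iff hp hp2 hp5, ← intCast_zmod_pow_eq_iff] at h
    exact_mod_cast h
  have hsurj : Function.Surjective fun k => (l k : ZMod (p ^ j)) := by
    have hinj : Function.Injective fun x : ZMod (p ^ j) => (l x.val : ZMod (p ^ j)) := by
      intro x y hxy
      wlog hle : x.val ≤ y.val generalizing x y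
      · exact (this hxy.symm (le_of_not_ge hle)).symm
      obtain ⟨t, ht⟩ := Nat.exists_eq_add_of_le hle
      have h := (hdiff x.val t).1 (by rw [← ht]; exact hxy.symm)
      rw [← ZMod.natCast_zmod_val x, ← ZMod.natCast_zmod_val y, ht, Nat.cast_add,
        (ZMod.natCast_eq_zero_iff t _).2 h, add_zero]
    intro z
    obtain ⟨x, hx⟩ := Finite.surjective_of_injective hinj z
    exact ⟨x.val, hx⟩
  have hfib : ∀ x t, ((Nat.fib (i + pisano p * (x + t)) : ZMod (p ^ (2 * wallExp p + j))) =
      Nat.fib (i + pisano p * x) ↔ (l (x + t) : ZMod (p ^ j)) ^ 2 = l x ^ 2) := fun x t => by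
    have h := pow_dvd_fib_add_sub_iff (fun n => fib_add_pisano_mul hp hp2 hp5 n t) hp hp2 hp5
      (hL' x) (2 * wallExp p + j)
    rw [add_assoc, ← mul_add, hlz, hlz, mul_pow, mul_pow, ← mul_sub, ← pow_mul,
      mul_comm (wallExp p) 2, pow_dvd_pow_mul_iff hp, ← intCast_zmod_pow_eq_iff,
      ← intCast_zmod_pow_eq_iff] at h
    exact_mod_cast h
  rw [← natCard_range_sq_of_surjective hsurj, ← natCard_range_congr (f := fun k : ℕ =>
    (Nat.fib (i + pisano p * k) : ZMod (p ^ (2 * wallExp p + j))))]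
  · congr 2
    ext z
    constructor
    · rintro ⟨n, hn, rfl⟩
      exact ⟨n / pisano p, by simp only [← hn, Nat.mod_add_div]⟩
    · rintro ⟨k, rfl⟩
      exact ⟨_, by rw [Nat.add_mul_mod_self_left, Nat.mod_eq_of_lt hi], rfl⟩
  · intro x y
    rcases le_total x y with hle | hle
    · obtain ⟨t, rfl⟩ := Nat.exists_eq_add_of_le hle
      rw [eq_comm, hfib, eq_comm]
    · obtain ⟨t, rfl⟩ := Nat.exists_eq_add_of_le hle
      exact hfib y t

end OddPrime

theorem lucas_zero_branch_density
    (p : ℕ) (hp : p.Prime) (hp2 : p ≠ 2) (hp5 : p ≠ 5)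
    (i : ℕ) (hi : i < pisano p) (hL : p ∣ lucas i) :
    Filter.Tendsto
      (fun lam : ℕ =>
        (Nat.card {x : ZMod (p ^ lam) |
          ∃ n : ℕ, n % pisano p = i ∧ (Nat.fib n : ZMod (p ^ lam)) = x} : ℝ) / (p : ℝ) ^ lam)
      Filter.atTop
      (nhds (1 / (2 * (p : ℝ) ^ (2 * wallExp p - 1) * ((p : ℝ) + 1)))) := by
  have hp0 : (p : ℝ) ≠ 0 := Nat.cast_ne_zero.2 hp.ne_zero
  have he := one_le_wallExp hp hp2 hp5
  rw [← Filter.tendsto_add_atTop_iff_nat (2 * wallExp p)]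
  have h := (tendsto_sqCount_div hp hp2).div_const ((p : ℝ) ^ (2 * wallExp p))
  have hlim : (p / (2 * (p + 1)) / (p : ℝ) ^ (2 * wallExp p)) =
      1 / (2 * (p : ℝ) ^ (2 * wallExp p - 1) * ((p : ℝ) + 1)) := by
    obtain ⟨r, hr⟩ : ∃ r, 2 * wallExp p = r + 1 := ⟨2 * wallExp p - 1, by omega⟩
    have : (p : ℝ) + 1 ≠ 0 := by positivity
    rw [hr, Nat.add_sub_cancel]
    field_simp
    ring
  rw [hlim] at h
  refine h.congr fun j => ?_
  rw [add_comm j, natCard_fib_residues hp hp2 hp5 hi hL, div_div, pow_add, mul_comm]
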